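/- arXiv:0906.3162 — 3 statements merged into one kernel-verified Lean document; each statement's English description precedes it below -/
import Mathlib

section
/- Let n ≥ 2, let γ ≥ 1, let W be a γ-stable Max-Cut instance on Fin n with maximal cut S, and let i, j ∈ S with i ≠ j. Define the merged instance W' : Matrix {v : Fin n // v ≠ j} {v : Fin n // v ≠ j} ℝ by W' a b = W a b when a ≠ i and b ≠ i, W' i b = W i b + W j b when b ≠ i, W' a i = W a i + W a j when a ≠ i, and W' i i = 0. Then W' is a γ-stable Max-Cut instance whose maximal cut is S' = {v : Fin n // v ≠ j | (v : Fin n) ∈ S}. -/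
open Finset Matrix

/-- Cut weight of `S`: sum of `W i j` over `i ∈ S`, `j ∉ S`. -/
def cutWeight {V : Type*} [Fintype V] [DecidableEq V] (W : Matrix V V ℝ) (S : Finset V) : ℝ :=
  ∑ i ∈ S, ∑ j ∈ Sᶜ, W i j

/-- `S` is a maximal cut of `W`. -/
def IsMaxCut {V : Type*} [Fintype V] [DecidableEq V] (W : Matrix V V ℝ) (S : Finset V) : Prop :=
  ∀ T : Finset V, cutWeight W T ≤ cutWeight W S

/-- `W'` is a `γ`-perturbation of `W`. -/
def IsPerturbation {V : Type*} (γ : ℝ) (W W' : Matrix V V ℝ) : Prop :=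
  W'.IsSymm ∧ ∀ i j, W i j ≤ W' i j ∧ W' i j ≤ γ * W i j

/-- The matrix obtained by summing the entries of `W` over the fibers of `p`. -/
def fiberSum {V V' : Type*} [Fintype V] [DecidableEq V'] (p : V → V') (W : Matrix V V ℝ) :
    Matrix V' V' ℝ :=
  fun a b => ∑ x with p x = a, ∑ y with p y = b, W x y

theorem cutWeight_congr {V : Type*} [Fintype V] [DecidableEq V] {W U : Matrix V V ℝ}
    (h : ∀ a b, a ≠ b → W a b = U a b) (T : Finset V) : cutWeight W T = cutWeight U T := by
  refine sum_congr rfl fun a ha => sum_congr rfl fun b hb => h a b ?_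
  rintro rfl
  exact mem_compl.1 hb ha

theorem cutWeight_fiberSum {V V' : Type*} [Fintype V] [DecidableEq V] [Fintype V']
    [DecidableEq V'] (p : V → V') (U : Matrix V V ℝ) (T : Finset V') :
    cutWeight (fiberSum p U) T = cutWeight U (univ.filter fun x => p x ∈ T) := by
  have key (R : Finset V') (f : V → ℝ) :
      ∑ a ∈ R, ∑ x with p x = a, f x = ∑ x with p x ∈ R, f x := by
    simp only [sum_filter]
    rw [sum_comm]
    exact sum_congr rfl fun x _ => by simp
  have hcompl : (univ.filter fun x => p x ∈ T)ᶜ = univ.filter fun x => p x ∈ Tᶜ := by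
    ext x
    simp
  unfold cutWeight fiberSum
  rw [hcompl, ← key]
  refine sum_congr rfl fun a _ => ?_
  rw [sum_comm]
  exact sum_congr rfl fun x _ => key _ _

/-- Every perturbation of a merged instance comes from a perturbation of the original one. -/
theorem exists_isPerturbation_fiberSum {V V' : Type*} [Fintype V] [DecidableEq V']
    {γ : ℝ} (hγ : 1 ≤ γ) {W : Matrix V V ℝ} (hsymm : W.IsSymm) (hnonneg : ∀ x y, 0 ≤ W x y)
    (p : V → V') {W' W'' : Matrix V' V' ℝ} (hW'symm : W'.IsSymm)
    (hW' : ∀ a b, a ≠ b → W' a b = fiberSum p W a b) (hpert : IsPerturbation γ W' W'') :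
    ∃ U, IsPerturbation γ W U ∧ ∀ a b, a ≠ b → W'' a b = fiberSum p U a b := by
  have hle (x y : V) (hxy : p x ≠ p y) : W x y ≤ W' (p x) (p y) := by
    rw [hW' _ _ hxy]
    refine (single_le_sum (f := fun y => W x y) (fun z _ => hnonneg x z)
      (by simp : y ∈ univ.filter fun z => p z = p y)).trans ?_
    exact single_le_sum (f := fun x => ∑ z with p z = p y, W x z)
      (fun w _ => sum_nonneg fun z _ => hnonneg w z)
      (by simp : x ∈ univ.filter fun z => p z = p x)
  refine ⟨of fun x y => if p x = p y then W x y else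
    W x y * (W'' (p x) (p y) / W' (p x) (p y)), ⟨?_, fun x y => ?_⟩, fun a b hab => ?_⟩
  · refine IsSymm.ext fun x y => ?_
    simp only [of_apply]
    rw [hsymm.apply, hpert.1.apply, hW'symm.apply]
    simp only [eq_comm]
  · obtain ⟨h₁, h₂⟩ := hpert.2 (p x) (p y)
    have h₀ := hnonneg x y
    by_cases hxy : p x = p y
    · simp only [of_apply, if_pos hxy]
      exact ⟨le_rfl, le_mul_of_one_le_left h₀ hγ⟩
    simp only [of_apply, if_neg hxy]
    have hxyle := hle x y hxy
    rcases h₀.eq_or_lt with h | h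
    · simp [← h]
    have hpos := h.trans_le hxyle
    rw [mul_comm γ]
    exact ⟨le_mul_of_one_le_right h₀ ((one_le_div hpos).2 h₁),
      mul_le_mul_of_nonneg_left ((div_le_iff₀ hpos).2 h₂) h₀⟩
  · have hU : fiberSum p (of fun x y => if p x = p y then W x y else
        W x y * (W'' (p x) (p y) / W' (p x) (p y))) a b =
        fiberSum p W a b * (W'' a b / W' a b) := by
      simp only [fiberSum, sum_mul, of_apply]
      refine sum_congr rfl fun x hx => sum_congr rfl fun y hy => ?_
      simp only [mem_filter, mem_univ, true_and] at hx hy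
      rw [hx, hy, if_neg hab]
    rw [hU, ← hW' a b hab]
    obtain ⟨h₁, h₂⟩ := hpert.2 a b
    by_cases h : W' a b = 0
    · rw [h] at h₁ h₂ ⊢
      linarith
    · field_simp

theorem fiberSum_merge {V : Type*} [Fintype V] [DecidableEq V] {i j : V} (hij : i ≠ j)
    (W : Matrix V V ℝ) {a b : {v : V // v ≠ j}} (hab : a ≠ b) :
    fiberSum (fun v => if h : v = j then (⟨i, hij⟩ : {v : V // v ≠ j}) else ⟨v, h⟩) W a b =
      if (a : V) = i ∧ (b : V) = i then 0
      else if (a : V) = i then W i b + W j b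
      else if (b : V) = i then W a i + W a j
      else W a b := by
  have hfiber (c : {v : V // v ≠ j}) :
      (univ.filter fun v => (if h : v = j then (⟨i, hij⟩ : {v : V // v ≠ j}) else ⟨v, h⟩) = c) =
        if (c : V) = i then {i, j} else {(c : V)} := by
    obtain ⟨c, hc⟩ := c
    ext v
    by_cases hv : v = j <;> by_cases hci : c = i <;> grind
  have hne : (a : V) ≠ b := fun h => hab (Subtype.ext h)
  unfold fiberSum
  rw [hfiber, hfiber]
  by_cases ha : (a : V) = i <;> by_cases hb : (b : V) = i
  · exact absurd (ha.trans hb.symm) hne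
  all_goals simp [ha, hb, sum_pair hij]

theorem statement5 {n : ℕ} (hn : 2 ≤ n) (γ : ℝ) (hγ : 1 ≤ γ)
    (W : Matrix (Fin n) (Fin n) ℝ)
    (hsymm : W.IsSymm) (hnonneg : ∀ i j, 0 ≤ W i j) (hdiag : ∀ i, W i i = 0)
    (S : Finset (Fin n)) (hmax : IsMaxCut W S)
    (hstab : ∀ W', IsPerturbation γ W W' →
      ∀ T : Finset (Fin n), cutWeight W' S ≤ cutWeight W' T → T = S ∨ T = Sᶜ)
    (i j : Fin n) (hiS : i ∈ S) (hjS : j ∈ S) (hij : i ≠ j)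
    (W' : Matrix {v : Fin n // v ≠ j} {v : Fin n // v ≠ j} ℝ)
    (hW' : ∀ a b : {v : Fin n // v ≠ j},
      W' a b =
        if (a : Fin n) = i ∧ (b : Fin n) = i then 0
        else if (a : Fin n) = i then W i (b : Fin n) + W j (b : Fin n)
        else if (b : Fin n) = i then W (a : Fin n) i + W (a : Fin n) j
        else W (a : Fin n) (b : Fin n))
    (S' : Finset {v : Fin n // v ≠ j})
    (hS' : S' = Finset.univ.filter (fun v : {v : Fin n // v ≠ j} => (v : Fin n) ∈ S)) :
    W'.IsSymm ∧ (∀ a b, 0 ≤ W' a b) ∧ (∀ a, W' a a = 0) ∧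
    IsMaxCut W' S' ∧
    (∀ W'', IsPerturbation γ W' W'' →
      ∀ T : Finset {v : Fin n // v ≠ j},
        cutWeight W'' S' ≤ cutWeight W'' T → T = S' ∨ T = S'ᶜ) := by
  set p : Fin n → {v : Fin n // v ≠ j} :=
    fun v => if h : v = j then ⟨i, hij⟩ else ⟨v, h⟩ with hp
  have hfiber (a b) (hab : a ≠ b) : W' a b = fiberSum p W a b := by
    rw [hW', hp, fiberSum_merge hij W hab]
  have hsurj : Function.Surjective p := fun a => ⟨a, by simp [hp, a.2]⟩
  have hpre : (univ.filter fun v => p v ∈ S') = S := by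
    ext v
    by_cases hv : v = j <;> simp [hS', hp, hv, hiS, hjS]
  have hW'symm : W'.IsSymm := by
    ext a b
    rw [transpose_apply, hW', hW']
    grind [hsymm.apply]
  refine ⟨hW'symm, fun a b => ?_, fun a => ?_, fun T => ?_, fun W'' hpert T hT => ?_⟩
  · rw [hW']
    split_ifs
    exacts [le_rfl, add_nonneg (hnonneg _ _) (hnonneg _ _),
      add_nonneg (hnonneg _ _) (hnonneg _ _), hnonneg _ _]
  · rw [hW']
    split_ifs <;> simp_all
  · rw [cutWeight_congr hfiber, cutWeight_congr hfiber, cutWeight_fiberSum,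
      cutWeight_fiberSum, hpre]
    exact hmax _
  · obtain ⟨U, hU, hUW⟩ :=
      exists_isPerturbation_fiberSum hγ hsymm hnonneg p hW'symm hfiber hpert
    rw [cutWeight_congr hUW, cutWeight_congr hUW, cutWeight_fiberSum,
      cutWeight_fiberSum, hpre] at hT
    refine (hstab U hU _ hT).imp (fun h => ?_) fun h => ?_
    all_goals
      rw [← hpre] at h
      ext a
      obtain ⟨v, rfl⟩ := hsurj a
      simpa using congrArg (v ∈ ·) h
end

section
/- Let n ≥ 2, let W be a Max-Cut instance on Fin n with ∑_j W i j > 0 for every i, let τ ≥ 1, and write w(i) = ∑_j W i j. Define the doubled instance M on Fin n ⊕ Fin n by M (inl i) (inl j) = M (inr i) (inr j) = W i j, and M (inl i) (inr j) = M (inr j) (inl i) = (if i = j then τ * w(i) else 0). Then: (1) S is a maximal cut of W if and only if Ŝ = (Finset.image inl S) ∪ (Finset.image inr Sᶜ) is a maximal cut of M; and (2) if S is a maximal cut of W, then M is 2τ-locally stable with respect to Ŝ. -/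
open Finset Matrix

/-- `W` with maximal cut `S` is `γ`-locally stable. -/
def IsLocallyStable {V : Type*} [Fintype V] [DecidableEq V]
    (γ : ℝ) (W : Matrix V V ℝ) (S : Finset V) : Prop :=
  (∀ v ∈ S, γ * ∑ u ∈ S, W u v < ∑ u ∈ Sᶜ, W u v) ∧
  (∀ v ∈ Sᶜ, γ * ∑ u ∈ Sᶜ, W u v < ∑ u ∈ S, W u v)

/-- The doubled instance `G^×` on `Fin n ⊕ Fin n`. -/
def doubled {n : ℕ} (W : Matrix (Fin n) (Fin n) ℝ) (τ : ℝ) :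
    Matrix (Fin n ⊕ Fin n) (Fin n ⊕ Fin n) ℝ
  | Sum.inl i, Sum.inl j => W i j
  | Sum.inl i, Sum.inr j => if i = j then τ * ∑ k, W i k else 0
  | Sum.inr i, Sum.inl j => if j = i then τ * ∑ k, W j k else 0
  | Sum.inr i, Sum.inr j => W i j

namespace MaxCut

section General

variable {V : Type*} [Fintype V] [DecidableEq V] {W : Matrix V V ℝ}

theorem cutWeight_eq_sum_compl (S : Finset V) :
    cutWeight W S = ∑ j ∈ Sᶜ, ∑ i ∈ S, W i j :=
  Finset.sum_comm

theorem cutWeight_compl (hsymm : W.IsSymm) (S : Finset V) :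
    cutWeight W Sᶜ = cutWeight W S := by
  rw [cutWeight_eq_sum_compl, compl_compl]
  simp only [cutWeight, hsymm.apply]

theorem _root_.IsMaxCut.compl (hsymm : W.IsSymm) {S : Finset V} (hS : IsMaxCut W S) :
    IsMaxCut W Sᶜ := fun T => by
  rw [cutWeight_compl hsymm]
  exact hS T

/-- In a maximal cut, moving a vertex to the other side does not increase the weight. -/
theorem _root_.IsMaxCut.sum_le_sum_compl (hsymm : W.IsSymm) (hdiag : ∀ i, W i i = 0)
    {S : Finset V} (hS : IsMaxCut W S) {v : V} (hv : v ∈ S) :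
    ∑ u ∈ S, W u v ≤ ∑ u ∈ Sᶜ, W u v := by
  have h := hS (S.erase v)
  have hvc : v ∉ Sᶜ := by simpa using hv
  unfold cutWeight at h
  rw [← Finset.add_sum_erase S _ hv, Finset.compl_erase] at h
  simp only [Finset.sum_insert hvc, Finset.sum_add_distrib] at h
  rw [← Finset.add_sum_erase S _ hv, hdiag, zero_add]
  simp only [hsymm.apply v] at h ⊢
  linarith

end General

theorem image_union_image {α β : Type*} [DecidableEq α] [DecidableEq β]
    (A : Finset α) (B : Finset β) :
    A.image Sum.inl ∪ B.image Sum.inr = A.disjSum B := by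
  ext (x | x) <;> simp

theorem compl_disjSum {α β : Type*} [Fintype α] [Fintype β] [DecidableEq α] [DecidableEq β]
    (A : Finset α) (B : Finset β) : (A.disjSum B)ᶜ = Aᶜ.disjSum Bᶜ := by
  ext (x | x) <;> simp

variable {n : ℕ} {W : Matrix (Fin n) (Fin n) ℝ} {τ : ℝ}

theorem sum_doubled_inl (A B : Finset (Fin n)) (i : Fin n) :
    ∑ u ∈ A.disjSum B, doubled W τ u (Sum.inl i) =
      ∑ u ∈ A, W u i + if i ∈ B then τ * ∑ k, W i k else 0 := by
  simp [Finset.sum_disjSum, doubled]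

theorem sum_doubled_inr (A B : Finset (Fin n)) (i : Fin n) :
    ∑ u ∈ A.disjSum B, doubled W τ u (Sum.inr i) =
      ∑ u ∈ B, W u i + if i ∈ A then τ * ∑ k, W i k else 0 := by
  simp [Finset.sum_disjSum, doubled, add_comm]

theorem cutWeight_doubled (A B : Finset (Fin n)) :
    cutWeight (doubled W τ) (A.disjSum B) = cutWeight W A + cutWeight W B +
      (∑ i ∈ Aᶜ ∩ B, τ * ∑ k, W i k + ∑ i ∈ Bᶜ ∩ A, τ * ∑ k, W i k) := by
  simp only [cutWeight_eq_sum_compl]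
  rw [compl_disjSum, Finset.sum_disjSum]
  simp only [sum_doubled_inl, sum_doubled_inr, Finset.sum_add_distrib, Finset.sum_ite_mem]
  ring

theorem cutWeight_doubled_compl (hsymm : W.IsSymm) (S : Finset (Fin n)) :
    cutWeight (doubled W τ) (S.disjSum Sᶜ) =
      2 * cutWeight W S + ∑ i, τ * ∑ k, W i k := by
  rw [cutWeight_doubled, cutWeight_compl hsymm, compl_compl, Finset.inter_self,
    Finset.inter_self, Finset.sum_compl_add_sum]
  ring

theorem cutWeight_doubled_le (hnonneg : ∀ i, 0 ≤ τ * ∑ k, W i k) (A B : Finset (Fin n)) :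
    cutWeight (doubled W τ) (A.disjSum B) ≤
      cutWeight W A + cutWeight W B + ∑ i, τ * ∑ k, W i k := by
  rw [cutWeight_doubled, ← Finset.sum_compl_add_sum A]
  gcongr
  · exact fun i _ _ => hnonneg i
  · exact Finset.inter_subset_left
  · exact fun i _ _ => hnonneg i
  · exact Finset.inter_subset_right

theorem isMaxCut_iff_doubled (hsymm : W.IsSymm) (hnonneg : ∀ i, 0 ≤ τ * ∑ k, W i k)
    (S : Finset (Fin n)) :
    IsMaxCut W S ↔ IsMaxCut (doubled W τ) (S.disjSum Sᶜ) := by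
  refine ⟨fun h T => ?_, fun h T => ?_⟩
  · rw [← Finset.toLeft_disjSum_toRight (u := T), cutWeight_doubled_compl hsymm]
    linarith [cutWeight_doubled_le hnonneg T.toLeft T.toRight, h T.toLeft, h T.toRight]
  · have := h (T.disjSum Tᶜ)
    rw [cutWeight_doubled_compl hsymm, cutWeight_doubled_compl hsymm] at this
    linarith

theorem sum_add_sum_compl_col (hsymm : W.IsSymm) (S : Finset (Fin n)) (i : Fin n) :
    ∑ u ∈ S, W u i + ∑ u ∈ Sᶜ, W u i = ∑ k, W i k := by
  rw [Finset.sum_add_sum_compl]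
  simp only [hsymm.apply]

theorem two_mul_mul_sum_lt (hsymm : W.IsSymm) (hdiag : ∀ i, W i i = 0)
    (hpos : ∀ i, 0 < ∑ j, W i j) (hτ : 0 ≤ τ) {S : Finset (Fin n)} (hS : IsMaxCut W S)
    {i : Fin n} (hi : i ∈ S) :
    2 * τ * ∑ u ∈ S, W u i < ∑ u ∈ Sᶜ, W u i + τ * ∑ k, W i k := by
  have h := hS.sum_le_sum_compl hsymm hdiag hi
  have hp := hpos i
  rw [← sum_add_sum_compl_col hsymm S i] at hp ⊢
  linarith [mul_le_mul_of_nonneg_left h hτ]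

theorem doubled_stable_side (hsymm : W.IsSymm) (hdiag : ∀ i, W i i = 0)
    (hpos : ∀ i, 0 < ∑ j, W i j) (hτ : 0 ≤ τ) {S : Finset (Fin n)} (hS : IsMaxCut W S) :
    ∀ v ∈ S.disjSum Sᶜ, 2 * τ * ∑ u ∈ S.disjSum Sᶜ, doubled W τ u v <
      ∑ u ∈ Sᶜ.disjSum S, doubled W τ u v := by
  rintro (i | i) hv
  · have hi : i ∈ S := by simpa using hv
    rw [sum_doubled_inl, sum_doubled_inl, if_neg (by simpa using hi), if_pos hi, add_zero]
    exact two_mul_mul_sum_lt hsymm hdiag hpos hτ hS hi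
  · have hi : i ∈ Sᶜ := by simpa using hv
    rw [sum_doubled_inr, sum_doubled_inr, if_neg (by simpa using hi), if_pos hi, add_zero]
    simpa only [compl_compl] using
      two_mul_mul_sum_lt hsymm hdiag hpos hτ (hS.compl hsymm) hi

end MaxCut

theorem statement6 {n : ℕ} (hn : 2 ≤ n)
    (W : Matrix (Fin n) (Fin n) ℝ)
    (hsymm : W.IsSymm) (hnonneg : ∀ i j, 0 ≤ W i j) (hdiag : ∀ i, W i i = 0)
    (hpos : ∀ i, 0 < ∑ j, W i j)
    (τ : ℝ) (hτ : 1 ≤ τ)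
    (S : Finset (Fin n)) :
    (IsMaxCut W S ↔
      IsMaxCut (doubled W τ) (S.image Sum.inl ∪ Sᶜ.image Sum.inr)) ∧
    (IsMaxCut W S →
      IsLocallyStable (2 * τ) (doubled W τ) (S.image Sum.inl ∪ Sᶜ.image Sum.inr)) := by
  have hτ₀ : 0 ≤ τ := zero_le_one.trans hτ
  rw [MaxCut.image_union_image]
  refine ⟨MaxCut.isMaxCut_iff_doubled hsymm (fun i => mul_nonneg hτ₀ (hpos i).le) S,
    fun hS => ?_⟩
  unfold IsLocallyStable
  rw [MaxCut.compl_disjSum, compl_compl]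
  refine ⟨MaxCut.doubled_stable_side hsymm hdiag hpos hτ₀ hS, ?_⟩
  simpa only [compl_compl] using
    MaxCut.doubled_stable_side hsymm hdiag hpos hτ₀ (hS.compl hsymm)
end

section
/- Let n ≥ 2, let W be a Max-Cut instance on Fin n, let τ ≥ 1 and γ ≥ 1, and write w(i) = ∑_j W i j. Define the doubled instance M on Fin n ⊕ Fin n by M (inl i) (inl j) = M (inr i) (inr j) = W i j, and M (inl i) (inr j) = M (inr j) (inl i) = (if i = j then τ * w(i) else 0). Then W is γ-stable if and only if M is γ-stable. -/
open Finset Matrix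

/-- `W` is `γ`-stable. -/
def IsStable {V : Type*} [Fintype V] [DecidableEq V] (γ : ℝ) (W : Matrix V V ℝ) : Prop :=
  ∃ S : Finset V, IsMaxCut W S ∧ ∀ W', IsPerturbation γ W W' →
    ∀ T : Finset V, cutWeight W' S ≤ cutWeight W' T → T = S ∨ T = Sᶜ

theorem cutWeight_compl {V : Type*} [Fintype V] [DecidableEq V] {W : Matrix V V ℝ}
    (hW : W.IsSymm) (S : Finset V) : cutWeight W Sᶜ = cutWeight W S := by
  unfold cutWeight
  rw [compl_compl]
  exact Finset.sum_comm.trans <|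
    Finset.sum_congr rfl fun i _ => Finset.sum_congr rfl fun j _ => hW.apply i j

theorem compl_disjSum {α β : Type*} [Fintype α] [Fintype β] [DecidableEq α] [DecidableEq β]
    (A : Finset α) (B : Finset β) : (A.disjSum B)ᶜ = Aᶜ.disjSum Bᶜ := by
  ext (x | x) <;> simp

theorem cutWeight_fromBlocks {V : Type*} [Fintype V] [DecidableEq V] (W₁ W₂ : Matrix V V ℝ)
    (d : V → ℝ) (A B : Finset V) :
    cutWeight (fromBlocks W₁ (diagonal d) (diagonal d) W₂) (A.disjSum B) =
      cutWeight W₁ A + cutWeight W₂ B + ∑ i, if i ∈ A ↔ i ∈ B then 0 else d i := by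
  have hdiag : ∀ A B : Finset V, ∑ i ∈ A, ∑ j ∈ Bᶜ, diagonal d i j =
      ∑ i, if i ∈ A ∧ i ∉ B then d i else 0 := by
    intro A B
    simp only [diagonal_apply, Finset.sum_ite_eq, Finset.mem_compl]
    rw [← Finset.sum_filter, ← Finset.sum_filter]
    congr 1
    ext i
    simp
  have hsplit : (∑ i, if i ∈ A ↔ i ∈ B then 0 else d i) =
      (∑ i, if i ∈ A ∧ i ∉ B then d i else 0) + ∑ i, if i ∈ B ∧ i ∉ A then d i else 0 := by
    rw [← Finset.sum_add_distrib]
    refine Finset.sum_congr rfl fun i _ => ?_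
    by_cases hA : i ∈ A <;> by_cases hB : i ∈ B <;> simp [hA, hB]
  rw [hsplit, ← hdiag, ← hdiag]
  simp only [cutWeight, compl_disjSum, Finset.sum_disjSum, fromBlocks_apply₁₁, fromBlocks_apply₁₂,
    fromBlocks_apply₂₁, fromBlocks_apply₂₂, Finset.sum_add_distrib]
  ring

theorem cutWeight_fromBlocks_compl {V : Type*} [Fintype V] [DecidableEq V]
    {W₁ W₂ : Matrix V V ℝ} (hW₂ : W₂.IsSymm) (d : V → ℝ) (A : Finset V) :
    cutWeight (fromBlocks W₁ (diagonal d) (diagonal d) W₂) (A.disjSum Aᶜ) =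
      cutWeight W₁ A + cutWeight W₂ A + ∑ i, d i := by
  rw [cutWeight_fromBlocks, cutWeight_compl hW₂]
  congr 1
  refine Finset.sum_congr rfl fun i _ => ?_
  by_cases h : i ∈ A <;> simp [h]

theorem sum_ite_iff_mem_le {V : Type*} [Fintype V] [DecidableEq V] {d : V → ℝ}
    (hd : ∀ i, 0 ≤ d i) (A B : Finset V) :
    (∑ i, if i ∈ A ↔ i ∈ B then 0 else d i) ≤ ∑ i, d i :=
  Finset.sum_le_sum fun i _ => by split_ifs <;> simp [hd i]

theorem eq_of_eq_compl_self {V : Type*} [Fintype V] [DecidableEq V]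
    {A : Finset V} (h : A = Aᶜ) (B C : Finset V) : B = C := by
  have : IsEmpty V := ⟨fun i => by simpa using congrArg (i ∈ ·) h⟩
  exact Subsingleton.elim B C

theorem IsPerturbation.refl {V : Type*} {γ : ℝ} (hγ : 1 ≤ γ) {W : Matrix V V ℝ}
    (hW : W.IsSymm) (hnonneg : ∀ i j, 0 ≤ W i j) : IsPerturbation γ W W :=
  ⟨hW, fun i j => ⟨le_rfl, le_mul_of_one_le_left (hnonneg i j) hγ⟩⟩

/-- The defining property of a stable cut forces it to be maximal in every perturbation. -/
theorem isMaxCut_of_forall_eq_or_eq_compl {V : Type*} [Fintype V] [DecidableEq V]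
    {W : Matrix V V ℝ} (hW : W.IsSymm) {S : Finset V}
    (hS : ∀ T, cutWeight W S ≤ cutWeight W T → T = S ∨ T = Sᶜ) : IsMaxCut W S := by
  intro T
  by_contra! h
  rcases hS T h.le with rfl | rfl
  · exact h.false
  · exact h.ne' (cutWeight_compl hW S)

theorem IsStable.ne_zero {V : Type*} [Fintype V] [DecidableEq V] [Nontrivial V] {γ : ℝ}
    {W : Matrix V V ℝ} (h : IsStable γ W) : W ≠ 0 := by
  rintro rfl
  obtain ⟨S, -, hS⟩ := h
  have hT : ∀ T, T = S ∨ T = Sᶜ := fun T =>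
    hS 0 ⟨Matrix.transpose_zero, fun i j => by simp⟩ T (by simp [cutWeight])
  obtain ⟨a, b, hab⟩ := exists_pair_ne V
  have hab' : ({a} : Finset V) ≠ {b} := by simpa using hab
  have ha : ({a} : Finset V) ≠ ∅ := Finset.singleton_ne_empty a
  have hb : ({b} : Finset V) ≠ ∅ := Finset.singleton_ne_empty b
  rcases hT ∅ with h₀ | h₀ <;> rcases hT {a} with h₁ | h₁ <;> rcases hT {b} with h₂ | h₂ <;>
    simp_all only [ne_eq, not_true_eq_false]

theorem doubled_eq_fromBlocks {n : ℕ} (W : Matrix (Fin n) (Fin n) ℝ) (τ : ℝ) :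
    doubled W τ = fromBlocks W (diagonal fun i => τ * ∑ k, W i k)
      (diagonal fun i => τ * ∑ k, W i k) W := by
  ext (i | i) (j | j)
  · rfl
  · simp [doubled, diagonal_apply]
  · by_cases h : j = i
    · subst h; simp [doubled]
    · simp [doubled, h, Ne.symm h]
  · rfl

theorem isSymm_fromBlocks_diagonal {V : Type*} [DecidableEq V] {W₁ W₂ : Matrix V V ℝ}
    (h₁ : W₁.IsSymm) (h₂ : W₂.IsSymm) (d : V → ℝ) :
    (fromBlocks W₁ (diagonal d) (diagonal d) W₂).IsSymm :=
  h₁.fromBlocks (diagonal_transpose d) h₂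

/-- A perturbation of a block matrix with diagonal off-diagonal blocks has the same shape. -/
theorem IsPerturbation.exists_eq_fromBlocks {V : Type*} [DecidableEq V] {γ : ℝ}
    {W : Matrix V V ℝ} {d : V → ℝ} {M : Matrix (V ⊕ V) (V ⊕ V) ℝ}
    (hM : IsPerturbation γ (fromBlocks W (diagonal d) (diagonal d) W) M) :
    ∃ W₁ W₂ d', IsPerturbation γ W W₁ ∧ IsPerturbation γ W W₂ ∧ (∀ i, d i ≤ d' i) ∧
      M = fromBlocks W₁ (diagonal d') (diagonal d') W₂ := by
  obtain ⟨hsymm, hbound⟩ := hM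
  have hoff : ∀ i j, i ≠ j → M (Sum.inl i) (Sum.inr j) = 0 := by
    intro i j hij
    have h := hbound (Sum.inl i) (Sum.inr j)
    simp only [fromBlocks_apply₁₂, diagonal_apply_ne _ hij, mul_zero] at h
    exact le_antisymm h.2 h.1
  refine ⟨M.toBlocks₁₁, M.toBlocks₂₂, fun i => M (Sum.inl i) (Sum.inr i),
    ⟨?_, fun i j => hbound (Sum.inl i) (Sum.inl j)⟩,
    ⟨?_, fun i j => hbound (Sum.inr i) (Sum.inr j)⟩, fun i => ?_, ?_⟩
  · ext i j
    exact hsymm.apply (Sum.inl i) (Sum.inl j)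
  · ext i j
    exact hsymm.apply (Sum.inr i) (Sum.inr j)
  · simpa using (hbound (Sum.inl i) (Sum.inr i)).1
  · ext (i | i) (j | j)
    · rfl
    · by_cases h : i = j
      · subst h; simp
      · simp [h, hoff i j h]
    · rw [← hsymm.apply]
      by_cases h : i = j
      · subst h; simp
      · simp [h, hoff j i (Ne.symm h)]
    · rfl

theorem IsStable.fromBlocks_diagonal {V : Type*} [Fintype V] [DecidableEq V] {γ : ℝ}
    (hγ : 1 ≤ γ) {W : Matrix V V ℝ} (hW : W.IsSymm) (hnonneg : ∀ i j, 0 ≤ W i j)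
    {d : V → ℝ} (hd : ∀ i, 0 ≤ d i) (hpos : 0 < ∑ i, d i) (h : IsStable γ W) :
    IsStable γ (fromBlocks W (diagonal d) (diagonal d) W) := by
  obtain ⟨S, -, hS⟩ := h
  have key : ∀ M, IsPerturbation γ (fromBlocks W (diagonal d) (diagonal d) W) M →
      ∀ T, cutWeight M (S.disjSum Sᶜ) ≤ cutWeight M T →
        T = S.disjSum Sᶜ ∨ T = (S.disjSum Sᶜ)ᶜ := by
    intro M hM T hT
    obtain ⟨W₁, W₂, d', h₁, h₂, hd', rfl⟩ := hM.exists_eq_fromBlocks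
    obtain ⟨A, B, rfl⟩ : ∃ A B : Finset V, T = A.disjSum B :=
      ⟨_, _, (Finset.toLeft_disjSum_toRight (u := T)).symm⟩
    rw [cutWeight_fromBlocks_compl h₂.1, cutWeight_fromBlocks] at hT
    have hA := isMaxCut_of_forall_eq_or_eq_compl h₁.1 (hS W₁ h₁) A
    have hB := isMaxCut_of_forall_eq_or_eq_compl h₂.1 (hS W₂ h₂) B
    have hAB := sum_ite_iff_mem_le (fun i => (hd i).trans (hd' i)) A B
    have hne : A ≠ B := by
      rintro rfl
      have hle : ∑ i, d i ≤ ∑ i, d' i := Finset.sum_le_sum fun i _ => hd' i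
      simp only [if_true, Finset.sum_const_zero] at hT
      linarith
    rw [compl_disjSum, disjSum_inj, disjSum_inj, compl_compl]
    rcases hS W₁ h₁ A (by linarith) with hA' | hA' <;>
      rcases hS W₂ h₂ B (by linarith) with hB' | hB' <;> simp_all
  have hsymm := isSymm_fromBlocks_diagonal hW hW d
  have hrefl : IsPerturbation γ (fromBlocks W (diagonal d) (diagonal d) W)
      (fromBlocks W (diagonal d) (diagonal d) W) := by
    refine .refl hγ hsymm ?_
    rintro (i | i) (j | j)
    · exact hnonneg i j
    · by_cases h : i = j <;> simp [h, hd]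
    · by_cases h : i = j <;> simp [h, hd]
    · exact hnonneg i j
  exact ⟨S.disjSum Sᶜ, isMaxCut_of_forall_eq_or_eq_compl hsymm (key _ hrefl), key⟩

theorem IsStable.of_fromBlocks_diagonal {V : Type*} [Fintype V] [DecidableEq V] {γ : ℝ}
    (hγ : 1 ≤ γ) {W : Matrix V V ℝ} (hW : W.IsSymm) (hnonneg : ∀ i j, 0 ≤ W i j)
    {d : V → ℝ} (hd : ∀ i, 0 ≤ d i)
    (h : IsStable γ (fromBlocks W (diagonal d) (diagonal d) W)) : IsStable γ W := by
  obtain ⟨T, -, hT⟩ := h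
  have hpert : ∀ W', IsPerturbation γ W W' →
      IsPerturbation γ (fromBlocks W (diagonal d) (diagonal d) W)
        (fromBlocks W' (diagonal d) (diagonal d) W') := by
    intro W' hW'
    refine ⟨isSymm_fromBlocks_diagonal hW'.1 hW'.1 d, ?_⟩
    have hdiag : ∀ i j, diagonal d i j ≤ γ * diagonal d i j := by
      intro i j
      refine le_mul_of_one_le_left ?_ hγ
      by_cases h : i = j <;> simp [h, hd]
    rintro (i | i) (j | j)
    · exact hW'.2 i j
    · exact ⟨le_rfl, hdiag i j⟩
    · exact ⟨le_rfl, hdiag i j⟩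
    · exact hW'.2 i j
  have hrefl : IsPerturbation γ W W := .refl hγ hW hnonneg
  obtain ⟨A, B, rfl⟩ : ∃ A B : Finset V, T = A.disjSum B :=
    ⟨_, _, (Finset.toLeft_disjSum_toRight (u := T)).symm⟩
  -- Replacing one side by the complement of the other does not decrease the average weight.
  obtain rfl : B = Aᶜ := by
    have hAB := sum_ite_iff_mem_le hd A B
    have hA := hT _ (hpert W hrefl) (A.disjSum Aᶜ)
    have hB := hT _ (hpert W hrefl) (Bᶜ.disjSum B)
    have hBw := cutWeight_fromBlocks_compl (W₁ := W) hW d Bᶜ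
    rw [compl_compl, cutWeight_compl hW] at hBw
    rw [compl_disjSum, disjSum_inj, disjSum_inj, cutWeight_fromBlocks_compl hW,
      cutWeight_fromBlocks] at hA
    rw [compl_disjSum, disjSum_inj, disjSum_inj, hBw, cutWeight_fromBlocks] at hB
    rcases le_total (cutWeight W A) (cutWeight W B) with hle | hle
    · rcases hB (by linarith) with ⟨h, -⟩ | ⟨-, h⟩
      · rw [← h, compl_compl]
      · exact eq_of_eq_compl_self h _ _
    · rcases hA (by linarith) with ⟨-, h⟩ | ⟨h, -⟩
      · exact h.symm
      · exact eq_of_eq_compl_self h _ _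
  have key : ∀ W', IsPerturbation γ W W' →
      ∀ R, cutWeight W' A ≤ cutWeight W' R → R = A ∨ R = Aᶜ := by
    intro W' hW' R hR
    have := hT _ (hpert W' hW') (R.disjSum Rᶜ)
    rw [compl_disjSum, disjSum_inj, disjSum_inj, cutWeight_fromBlocks_compl hW'.1,
      cutWeight_fromBlocks_compl hW'.1] at this
    exact (this (by linarith)).imp And.left And.left
  exact ⟨A, isMaxCut_of_forall_eq_or_eq_compl hW (key W hrefl), key⟩

theorem statement7 {n : ℕ} (hn : 2 ≤ n)
    (W : Matrix (Fin n) (Fin n) ℝ)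
    (hsymm : W.IsSymm) (hnonneg : ∀ i j, 0 ≤ W i j) (hdiag : ∀ i, W i i = 0)
    (τ : ℝ) (hτ : 1 ≤ τ) (γ : ℝ) (hγ : 1 ≤ γ) :
    IsStable γ W ↔ IsStable γ (doubled W τ) := by
  have : Nontrivial (Fin n) := Fin.nontrivial_iff_two_le.2 hn
  have hsum : ∀ i, 0 ≤ ∑ k, W i k := fun i => Finset.sum_nonneg fun k _ => hnonneg i k
  have hd : ∀ i, 0 ≤ τ * ∑ k, W i k := fun i => mul_nonneg (by linarith) (hsum i)
  rw [doubled_eq_fromBlocks]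
  refine ⟨fun h => h.fromBlocks_diagonal hγ hsymm hnonneg hd ?_,
    fun h => h.of_fromBlocks_diagonal hγ hsymm hnonneg hd⟩
  refine (Finset.sum_nonneg fun i _ => hd i).lt_of_ne' fun hzero => h.ne_zero ?_
  ext i j
  have hi := (Finset.sum_eq_zero_iff_of_nonneg fun i _ => hd i).1 hzero i (Finset.mem_univ i)
  have hi' : ∑ k, W i k = 0 := (mul_eq_zero.1 hi).resolve_left (by linarith)
  exact (Finset.sum_eq_zero_iff_of_nonneg fun k _ => hnonneg i k).1 hi' j (Finset.mem_univ j)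
end
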